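/- Let k ≥ 1, let P ⊆ ℕ^k be a finite linearly independent (over ℚ) set of vectors, and let x₀ ∈ ℕ^k. Then there exists an index set I with |I| ≤ 2^k + 2k − 1 such that for each i ∈ I there are finite sets P_i, C_i ⊆ ℕ^k with ‖P_i‖ ≤ (2k+1) k^{k/2} (‖P‖+1)^k, ‖C_i‖ ≤ (2k+1) k^{k/2} (‖P‖+1)^k + ‖x₀‖, and |C_i| ≤ max(4^k k^{k²/2 + k} (‖P‖+1)^{k²}, ‖x₀‖), and ℕ^k \ L(x₀, P) = ⋃_{i ∈ I} L(C_i, P_i). -/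

import Mathlib

/-- Maximum norm of a vector in `ℕ^k`. -/
def vnorm {k : ℕ} (x : Fin k → ℕ) : ℕ := Finset.univ.sup x

/-- Maximum norm of a finite set of vectors in `ℕ^k` (`0` for the empty set). -/
def snorm {k : ℕ} (P : Finset (Fin k → ℕ)) : ℕ := P.sup vnorm

/-- The set `L(C,P) = { c + ∑_{x ∈ P} λ_x • x : c ∈ C, λ_x ∈ ℕ }`. -/
def LSet {k : ℕ} (C P : Finset (Fin k → ℕ)) : Set (Fin k → ℕ) :=
  {v | ∃ c ∈ C, ∃ lam : (Fin k → ℕ) → ℕ, v = c + ∑ x ∈ P, lam x • x}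

/-- The linear set `L(c,P)` with a single constant vector `c`. -/
def LSet1 {k : ℕ} (c : Fin k → ℕ) (P : Finset (Fin k → ℕ)) : Set (Fin k → ℕ) :=
  LSet {c} P

/-- A finite set of vectors of `ℕ^k` is linearly independent if its elements,
viewed as vectors in `ℚ^k`, are linearly independent. -/
def LinIndep {k : ℕ} (P : Finset (Fin k → ℕ)) : Prop :=
  LinearIndependent ℚ (fun x : P => fun i => ((x : Fin k → ℕ) i : ℚ))

theorem prod_le_mean_pow {k : ℕ} (hk : 1 ≤ k) (f : Fin k → ℝ) (hf : ∀ i, 0 ≤ f i) (T : ℝ)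
    (hT : ∑ i, f i ≤ k * T) : ∏ i, f i ≤ T ^ k := by
  have hk0 : (0 : ℝ) < k := by exact_mod_cast hk
  have h := Real.geom_mean_le_arith_mean Finset.univ (fun _ : Fin k => (1 : ℝ)) f
    (fun _ _ => zero_le_one) (by simpa using hk0) (fun i _ => hf i)
  simp only [Real.rpow_one, Finset.sum_const, Finset.card_univ, Fintype.card_fin, nsmul_eq_mul,
    mul_one, one_mul] at h
  have hP : 0 ≤ ∏ i, f i := Finset.prod_nonneg (fun i _ => hf i)
  have h2 : (∑ i, f i) / k ≤ T := by
    rw [div_le_iff₀ hk0]; linarith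
  have h3 := pow_le_pow_left₀ (Real.rpow_nonneg hP _) (h.trans h2) k
  rwa [Real.rpow_inv_natCast_pow hP (by omega)] at h3

theorem det_sq_le {k : ℕ} (hk : 1 ≤ k) (X : Matrix (Fin k) (Fin k) ℝ) (M : ℝ)
    (hX : ∀ i j, |X i j| ≤ M) : X.det ^ 2 ≤ (k * M ^ 2) ^ k := by
  have hps := Matrix.posSemidef_conjTranspose_mul_self X
  have hd := hps.1.det_eq_prod_eigenvalues
  have ht := hps.1.trace_eq_sum_eigenvalues
  have h1 : X.det ^ 2 = ∏ i, hps.1.eigenvalues i := by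
    simp only [RCLike.ofReal_real_eq_id, id] at hd
    rw [← hd, Matrix.det_mul, Matrix.det_conjTranspose]
    simp [sq]
  rw [h1]
  apply prod_le_mean_pow hk _ hps.eigenvalues_nonneg
  simp only [RCLike.ofReal_real_eq_id, id] at ht
  rw [← ht]
  simp only [Matrix.trace, Matrix.diag, Matrix.mul_apply, Matrix.conjTranspose_apply, star_trivial]
  have : ∀ i j, X j i * X j i ≤ M ^ 2 := fun i j => by
    rw [← sq, ← sq_abs]
    exact pow_le_pow_left₀ (abs_nonneg _) (hX j i) 2
  calc ∑ i, ∑ j, X j i * X j i ≤ ∑ i : Fin k, ∑ j : Fin k, M ^ 2 :=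
        Finset.sum_le_sum fun i _ => Finset.sum_le_sum fun j _ => this i j
    _ = _ := by simp

theorem abs_det_le {k : ℕ} (hk : 1 ≤ k) (X : Matrix (Fin k) (Fin k) ℤ) (M : ℕ)
    (hX : ∀ i j, |X i j| ≤ M) : ((|X.det| : ℤ) : ℝ) ≤ (k : ℝ) ^ ((k : ℝ) / 2) * (M : ℝ) ^ k := by
  have h := det_sq_le hk (X.map (Int.cast : ℤ → ℝ)) M (fun i j => by
    simp only [Matrix.map_apply]; exact_mod_cast hX i j)
  have hd : (X.map (Int.cast : ℤ → ℝ)).det = (X.det : ℝ) :=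
    (Int.cast_det X).symm
  rw [hd] at h
  rw [Int.cast_abs]
  refine abs_le_of_sq_le_sq ?_ (by positivity)
  have : ((k : ℝ) ^ ((k : ℝ) / 2)) ^ 2 = (k : ℝ) ^ k := by
    rw [← Real.rpow_natCast, ← Real.rpow_mul (by positivity)]
    norm_num
  rw [mul_pow, this]
  refine h.trans (le_of_eq ?_)
  rw [mul_pow]; ring

theorem basis_ext {k : ℕ} (P : Finset (Fin k → ℕ)) (hind : LinIndep P) :
    ∃ A : Matrix (Fin k) (Fin k) ℕ, (A.map (Nat.cast : ℕ → ℤ)).det ≠ 0 ∧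
      (∀ x ∈ P, ∃ j, A j = x) ∧ ∀ j, A j ∈ P ∨ ∃ i, A j = Pi.single i 1 := by
  classical
  let v : (Fin k → ℕ) → (Fin k → ℚ) := fun x i => (x i : ℚ)
  let t : Set (Fin k → ℕ) := ↑P ∪ Set.range (fun i => Pi.single i 1)
  have hs : LinearIndepOn ℚ v (↑P : Set (Fin k → ℕ)) := hind
  obtain ⟨b, hbt, hPb, hspan, hb⟩ := exists_linearIndepOn_extension hs
    (Set.subset_union_left : (↑P : Set (Fin k → ℕ)) ⊆ t)
  have htop : ⊤ ≤ Submodule.span ℚ (Set.range (fun x : b => v x)) := by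
    rw [← (Pi.basisFun ℚ (Fin k)).span_eq, Submodule.span_le]
    rintro _ ⟨i, rfl⟩
    have : Set.range (fun x : b => v x) = v '' b := by
      rw [Set.image_eq_range]
    rw [this]
    apply hspan
    refine ⟨Pi.single i 1, Or.inr ⟨i, rfl⟩, ?_⟩
    funext j
    simp only [v, Pi.basisFun_apply, Pi.single_apply]
    split_ifs <;> simp
  let bas := Module.Basis.mk hb htop
  have : Fintype b := FiniteDimensional.fintypeBasisIndex bas
  have hcard : Fintype.card b = k := by
    rw [← Module.finrank_eq_card_basis bas]; simp
  let e : Fin k ≃ b := (Fintype.equivFinOfCardEq hcard).symm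
  refine ⟨fun j => (e j : Fin k → ℕ), ?_, ?_, ?_⟩
  · have h1 : LinearIndependent ℚ (fun j => v (e j)) := hb.comp e e.injective
    have h2 := (Matrix.linearIndependent_rows_iff_isUnit
      (A := (fun j => v (e j) : Matrix (Fin k) (Fin k) ℚ))).1 h1
    have h3 := ((Matrix.isUnit_iff_isUnit_det _).1 h2).ne_zero
    intro h0
    apply h3
    have := congrArg (Int.cast : ℤ → ℚ) h0
    rw [Int.cast_det] at this
    rw [← Int.cast_zero, ← this]
    rfl
  · intro x hx
    exact ⟨e.symm ⟨x, hPb hx⟩, by simp⟩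
  · intro j
    rcases hbt (e j).2 with h | ⟨i, hi⟩
    · exact Or.inl h
    · exact Or.inr ⟨i, hi.symm⟩

theorem functionals {k : ℕ} (hk : 1 ≤ k) (A : Matrix (Fin k) (Fin k) ℕ)
    (hA : (A.map (Nat.cast : ℕ → ℤ)).det ≠ 0) (M : ℕ) (hM : 1 ≤ M) (hAM : ∀ i j, A i j ≤ M) :
    ∃ (a : Fin k → Fin k → ℤ) (d : ℤ), 0 < d ∧
      (∀ j l, ∑ i, a j i * (A l i : ℤ) = if j = l then d else 0) ∧
      (∀ (z : Fin k → ℤ) i, d * z i = ∑ j, (∑ m, a j m * z m) * (A j i : ℤ)) ∧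
      ∀ j i, ((|a j i| : ℤ) : ℝ) ≤ (k : ℝ) ^ ((k : ℝ) / 2) * (M : ℝ) ^ k := by
  set X := A.map (Nat.cast : ℕ → ℤ) with hX
  have key1 : ∀ j l, ∑ i, X.adjugate i j * X l i = if j = l then X.det else 0 := by
    intro j l
    have := congrFun (congrFun (Matrix.mul_adjugate X) l) j
    rw [Matrix.mul_apply] at this
    simp only [Matrix.smul_apply, Matrix.one_apply, smul_eq_mul, mul_ite, mul_one, mul_zero] at this
    rw [← Finset.sum_congr rfl (fun i _ => mul_comm (X l i) _), this]
    simp [eq_comm]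
  have key2 : ∀ (z : Fin k → ℤ) i, X.det * z i = ∑ j, (∑ m, X.adjugate m j * z m) * X j i := by
    intro z i
    have h : Matrix.vecMul (Matrix.vecMul z X.adjugate) X = X.det • z := by
      rw [Matrix.vecMul_vecMul, Matrix.adjugate_mul, Matrix.vecMul_smul, Matrix.vecMul_one]
    have := congrFun h i
    simp only [Matrix.vecMul, dotProduct, Pi.smul_apply, smul_eq_mul] at this
    rw [← this]
    refine Finset.sum_congr rfl fun j _ => ?_
    congr 1
    exact Finset.sum_congr rfl fun m _ => mul_comm _ _
  have key3 : ∀ j i, ((|X.adjugate i j| : ℤ) : ℝ) ≤ (k : ℝ) ^ ((k : ℝ) / 2) * (M : ℝ) ^ k := by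
    intro j i
    rw [Matrix.adjugate_apply]
    apply abs_det_le hk
    intro p q
    rw [Matrix.updateRow_apply]
    split_ifs
    · rw [Pi.single_apply]
      split_ifs
      · simpa using hM
      · simp
    · simp only [hX, Matrix.map_apply, Nat.abs_cast]
      exact_mod_cast hAM p q
  rcases lt_or_gt_of_ne hA with h | h
  · refine ⟨fun j i => -X.adjugate i j, -X.det, by omega, ?_, ?_, ?_⟩
    · intro j l
      have := key1 j l
      simp only [neg_mul, Finset.sum_neg_distrib]
      simp only [hX, Matrix.map_apply] at this ⊢
      rw [this]; split_ifs <;> simp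
    · intro z i
      simp only [neg_mul, Finset.sum_neg_distrib]
      rw [key2 z i]; rfl
    · intro j i
      rw [abs_neg]; exact key3 j i
  · exact ⟨fun j i => X.adjugate i j, X.det, h, key1, key2, key3⟩

theorem le_vnorm {k : ℕ} (x : Fin k → ℕ) (i : Fin k) : x i ≤ vnorm x :=
  Finset.le_sup (Finset.mem_univ i)

theorem vnorm_le {k : ℕ} {x : Fin k → ℕ} {N : ℕ} (h : ∀ i, x i ≤ N) : vnorm x ≤ N :=
  Finset.sup_le fun i _ => h i

theorem snorm_le {k : ℕ} {P : Finset (Fin k → ℕ)} {N : ℕ} (h : ∀ x ∈ P, ∀ i, x i ≤ N) :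
    snorm P ≤ N :=
  Finset.sup_le fun x hx => vnorm_le (h x hx)

theorem le_snorm {k : ℕ} {P : Finset (Fin k → ℕ)} {x : Fin k → ℕ} (hx : x ∈ P) (i : Fin k) :
    x i ≤ snorm P :=
  (le_vnorm x i).trans (Finset.le_sup (f := vnorm) hx)

theorem LSet_add_mem {k : ℕ} {C P : Finset (Fin k → ℕ)} {v p : Fin k → ℕ} (hv : v ∈ LSet C P)
    (hp : p ∈ P) : v + p ∈ LSet C P := by
  classical
  obtain ⟨c, hc, lam, rfl⟩ := hv
  refine ⟨c, hc, fun x => lam x + if x = p then 1 else 0, ?_⟩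
  simp only [add_smul, Finset.sum_add_distrib, ite_smul, one_smul, zero_smul]
  rw [Finset.sum_ite_eq' P p, if_pos hp, add_assoc]

theorem gen {k : ℕ} (V : Set (Fin k → ℕ)) (C Q : Finset (Fin k → ℕ)) (hC : ∀ c ∈ C, c ∈ V)
    (hup : ∀ v ∈ V, ∀ p ∈ Q, v + p ∈ V)
    (hdown : ∀ v ∈ V, v ∈ C ∨ ∃ p ∈ Q, p ≠ 0 ∧ ∃ w ∈ V, v = w + p) : V = LSet C Q := by
  classical
  apply Set.Subset.antisymm
  · have : ∀ n : ℕ, ∀ v ∈ V, ∑ i, v i = n → v ∈ LSet C Q := by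
      intro n
      induction n using Nat.strong_induction_on with
      | _ n ih =>
        intro v hv hn
        rcases hdown v hv with h | ⟨p, hp, hp0, w, hw, rfl⟩
        · exact ⟨v, h, fun _ => 0, by simp⟩
        · refine LSet_add_mem (ih (∑ i, w i) ?_ w hw rfl) hp
          rw [← hn]
          simp only [Pi.add_apply, Finset.sum_add_distrib]
          have : 0 < ∑ i, p i := by
            rcases Function.ne_iff.1 hp0 with ⟨i, hi⟩
            exact lt_of_lt_of_le (Nat.pos_of_ne_zero hi)
              (Finset.single_le_sum (f := p) (fun _ _ => Nat.zero_le _) (Finset.mem_univ i))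
          omega
    exact fun v hv => this _ v hv rfl
  · rintro _ ⟨c, hc, lam, rfl⟩
    have h1 : ∀ p ∈ Q, ∀ n : ℕ, ∀ v ∈ V, v + n • p ∈ V := by
      intro p hp n
      induction n with
      | zero => intro v hv; simpa using hv
      | succ n ih =>
        intro v hv
        rw [succ_nsmul, ← add_assoc]
        exact hup _ (ih v hv) p hp
    have h2 : ∀ S : Finset (Fin k → ℕ), S ⊆ Q → c + ∑ x ∈ S, lam x • x ∈ V := by
      intro S
      induction S using Finset.induction_on with
      | empty => intro _; simpa using hC c hc
      | insert p S hp ih =>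
        intro hS
        rw [Finset.sum_insert hp, add_comm (lam p • p), ← add_assoc]
        exact h1 p (hS (Finset.mem_insert_self _ _)) _ _
          (ih fun x hx => hS (Finset.mem_insert_of_mem hx))
    exact h2 Q (Finset.Subset.refl Q)

/-- A set with a representation of size controlled by `N`. -/
def Good {k : ℕ} (N : ℕ) (V : Set (Fin k → ℕ)) : Prop :=
  ∃ C Q : Finset (Fin k → ℕ), snorm Q ≤ N ∧ snorm C ≤ N ∧ C.card ≤ (N + 1) ^ k ∧ V = LSet C Q

theorem gen_box {k : ℕ} (N : ℕ) (V : Set (Fin k → ℕ)) (Q : Finset (Fin k → ℕ)) (hQ : snorm Q ≤ N)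
    (hup : ∀ v ∈ V, ∀ p ∈ Q, v + p ∈ V)
    (hdown : ∀ v ∈ V, ∀ i, N < v i → ∃ p ∈ Q, p ≠ 0 ∧ ∃ w ∈ V, v = w + p) : Good N V := by
  classical
  let C : Finset (Fin k → ℕ) := (Fintype.piFinset fun _ => Finset.range (N + 1)).filter (· ∈ V)
  refine ⟨C, Q, hQ, ?_, ?_, ?_⟩
  · apply snorm_le
    intro x hx i
    have := Fintype.mem_piFinset.1 (Finset.mem_filter.1 hx).1 i
    rw [Finset.mem_range] at this
    omega
  · refine (Finset.card_filter_le _ _).trans ?_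
    simp
  · apply gen V C Q (fun c hc => (Finset.mem_filter.1 hc).2) hup
    intro v hv
    by_cases h : ∃ i, N < v i
    · obtain ⟨i, hi⟩ := h
      exact Or.inr (hdown v hv i hi)
    · left
      push Not at h
      refine Finset.mem_filter.2 ⟨Fintype.mem_piFinset.2 fun i => ?_, hv⟩
      rw [Finset.mem_range]
      have := h i
      omega

theorem half_good {k : ℕ} (a : Fin k → ℤ) (B N : ℕ) (hB : ∀ i, |a i| ≤ B) (hBN : k * B + 1 ≤ N) :
    Good N {z : Fin k → ℕ | 1 ≤ ∑ i, a i * (z i : ℤ)} := by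
  classical
  let E : Finset (Fin k → ℕ) :=
    (Finset.univ.filter fun i => 0 ≤ a i).image fun i => Pi.single i 1
  let q : Fin k → Fin k → (Fin k → ℕ) := fun i j =>
    Pi.single i (a j).natAbs + Pi.single j (a i).natAbs
  let F : Finset (Fin k → ℕ) :=
    (Finset.univ.filter fun ij : Fin k × Fin k => 0 < a ij.1 ∧ a ij.2 < 0).image
      fun ij => q ij.1 ij.2
  have hE : ∀ i, ∑ l, a l * (((Pi.single i 1 : Fin k → ℕ) l : ℕ) : ℤ) = a i := by
    intro i
    simp [Pi.single_apply]
  have hq : ∀ i j, 0 < a i → a j < 0 → ∑ l, a l * ((q i j l : ℕ) : ℤ) = 0 := by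
    intro i j hi hj
    simp only [q, Pi.add_apply, Nat.cast_add, mul_add, Finset.sum_add_distrib, Pi.single_apply,
      Nat.cast_ite, mul_ite, Nat.cast_zero, mul_zero, Finset.sum_ite_eq', Finset.mem_univ, if_true]
    rw [Int.natCast_natAbs, Int.natCast_natAbs, abs_of_neg hj, abs_of_pos hi]
    ring
  have hkpos : ∀ _ : Fin k, 1 ≤ k := fun i => by have := i.2; omega
  have hadd : ∀ v w : Fin k → ℕ, ∑ i, a i * (((v + w) i : ℕ) : ℤ)
      = ∑ i, a i * (v i : ℤ) + ∑ i, a i * (w i : ℤ) := by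
    intro v w
    simp [mul_add, Finset.sum_add_distrib]
  have hBN' : ∀ _ : Fin k, B ≤ N := fun i => by
    have := Nat.le_mul_of_pos_left B (hkpos i); omega
  have habs : ∀ i, (a i).natAbs ≤ B := fun i => by have := hB i; rw [Int.abs_eq_natAbs] at this; omega
  have hsub : ∀ p v : Fin k → ℕ, p ≤ v → v = (v - p) + p := fun p v h => by
    funext i; have : p i ≤ v i := h i; simp only [Pi.add_apply, Pi.sub_apply]; omega
  apply gen_box N _ (E ∪ F)
  · apply snorm_le
    intro x hx i
    have hn := hBN' i
    rcases Finset.mem_union.1 hx with h | h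
    · obtain ⟨j, _, rfl⟩ := Finset.mem_image.1 h
      rw [Pi.single_apply]
      split_ifs <;> omega
    · obtain ⟨⟨j, l⟩, hjl, rfl⟩ := Finset.mem_image.1 h
      obtain ⟨h1, h2⟩ := (Finset.mem_filter.1 hjl).2
      have h3 := habs j
      have h4 := habs l
      have h5 : j ≠ l := by rintro rfl; simp only at h1 h2; omega
      simp only [q, Pi.add_apply, Pi.single_apply]
      split_ifs with h6 h7
      · exact absurd (h6.symm.trans h7) h5
      all_goals omega
  · intro v hv p hp
    simp only [Set.mem_ofPred_eq] at hv ⊢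
    rw [hadd]
    rcases Finset.mem_union.1 hp with h | h
    · obtain ⟨j, hj, rfl⟩ := Finset.mem_image.1 h
      have := (Finset.mem_filter.1 hj).2
      rw [hE]; omega
    · obtain ⟨⟨j, l⟩, hjl, rfl⟩ := Finset.mem_image.1 h
      obtain ⟨h1, h2⟩ := (Finset.mem_filter.1 hjl).2
      rw [hq j l h1 h2]; omega
  · intro v hv m hm
    simp only [Set.mem_ofPred_eq] at hv
    -- subtracting a unit vector
    have subE : 0 ≤ a m → 1 ≤ ∑ i, a i * (v i : ℤ) - a m → ∃ p ∈ E ∪ F, p ≠ 0 ∧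
        ∃ w ∈ {z : Fin k → ℕ | 1 ≤ ∑ i, a i * (z i : ℤ)}, v = w + p := by
      intro h0 h1
      have hle : (Pi.single m 1 : Fin k → ℕ) ≤ v := by
        intro i
        change (Pi.single m 1 : Fin k → ℕ) i ≤ v i
        rw [Pi.single_apply]
        split_ifs with h
        · subst h; omega
        · omega
      refine ⟨Pi.single m 1, Finset.mem_union_left _ (Finset.mem_image.2 ⟨m, by simp [h0], rfl⟩),
        by simp, v - Pi.single m 1, ?_, hsub _ _ hle⟩
      have h2 := hadd (v - Pi.single m 1) (Pi.single m 1)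
      rw [← hsub _ _ hle, hE] at h2
      simp only [Set.mem_ofPred_eq]
      omega
    have subF : ∀ i j, 0 < a i → a j < 0 → (a j).natAbs ≤ v i → (a i).natAbs ≤ v j →
        ∃ p ∈ E ∪ F, p ≠ 0 ∧
        ∃ w ∈ {z : Fin k → ℕ | 1 ≤ ∑ i, a i * (z i : ℤ)}, v = w + p := by
      intro i j hi hj h1 h2
      have hij : i ≠ j := by rintro rfl; omega
      have hle : q i j ≤ v := by
        intro l
        change q i j l ≤ v l
        simp only [q, Pi.add_apply, Pi.single_apply]
        split_ifs with h6 h7 h7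
        · exact absurd (h6.symm.trans h7) hij
        · subst h6; omega
        · subst h7; omega
        · omega
      refine ⟨q i j, Finset.mem_union_right _ (Finset.mem_image.2 ⟨(i, j), by simp [hi, hj], rfl⟩),
        ?_, v - q i j, ?_, hsub _ _ hle⟩
      · intro h
        have := congrFun h i
        simp [q] at this
        omega
      · have h3 := hadd (v - q i j) (q i j)
        rw [← hsub _ _ hle, hq i j hi hj] at h3
        simp only [Set.mem_ofPred_eq]
        omega
    rcases lt_trichotomy (a m) 0 with h | h | h
    · by_cases hx : ∃ i, 0 < a i ∧ (a m).natAbs ≤ v i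
      · obtain ⟨i, hi, hi2⟩ := hx
        refine subF i m hi h hi2 ?_
        have := habs i
        have := hBN' i
        omega
      · exfalso
        push Not at hx
        -- each term is bounded
        have hterm : ∀ i, a i * (v i : ℤ) ≤ (B : ℤ) * |a m| - (if i = m then |a m| * v m else 0) := by
          intro i
          split_ifs with him
          · subst him
            rw [abs_of_neg h]
            nlinarith [Int.natCast_nonneg B]
          · rcases le_or_gt (a i) 0 with h0 | h0
            · have : a i * (v i : ℤ) ≤ 0 :=
                mul_nonpos_of_nonpos_of_nonneg h0 (Int.natCast_nonneg _)
              have : (0 : ℤ) ≤ (B : ℤ) * |a m| := by positivity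
              omega
            · have h1 := hx i h0
              have h2 : (v i : ℤ) ≤ |a m| := by rw [Int.abs_eq_natAbs]; omega
              have h3 : a i ≤ B := (le_abs_self _).trans (hB i)
              have : a i * (v i : ℤ) ≤ (B : ℤ) * |a m| := by gcongr
              omega
        have hsum := Finset.sum_le_sum (s := Finset.univ) fun i _ => hterm i
        rw [Finset.sum_sub_distrib] at hsum
        simp only [Finset.sum_const, Finset.card_univ, Fintype.card_fin, nsmul_eq_mul,
          Finset.sum_ite_eq', Finset.mem_univ, if_true] at hsum
        have h5 : (0 : ℤ) < |a m| := abs_pos.2 h.ne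
        have h6 : ((k * B + 1 : ℕ) : ℤ) < v m := by exact_mod_cast lt_of_le_of_lt hBN hm
        push_cast at h6
        nlinarith
    · apply subE h.ge; omega
    · by_cases hx : ∃ j, a j < 0 ∧ (a m).natAbs ≤ v j
      · obtain ⟨j, hj, hj2⟩ := hx
        refine subF m j h hj ?_ hj2
        have := habs j
        have := hBN' j
        omega
      · push Not at hx
        apply subE h.le
        have hterm : ∀ i, (if i = m then a m * v m else 0) - (B : ℤ) * a m ≤ a i * (v i : ℤ) := by
          intro i
          have hBp : (0 : ℤ) ≤ (B : ℤ) * a m := by positivity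
          split_ifs with him
          · subst him
            omega
          · rcases le_or_gt 0 (a i) with h0 | h0
            · have : 0 ≤ a i * (v i : ℤ) := mul_nonneg h0 (Int.natCast_nonneg _)
              omega
            · have h1 := hx i h0
              have h2 : (v i : ℤ) ≤ a m := by omega
              have h3 : -a i ≤ B := (neg_le_abs _).trans (hB i)
              have : -a i * (v i : ℤ) ≤ (B : ℤ) * a m := by
                apply mul_le_mul h3 h2 (Int.natCast_nonneg _) (Int.natCast_nonneg _)
              linarith
        have hsum := Finset.sum_le_sum (s := Finset.univ) fun i _ => hterm i
        rw [Finset.sum_sub_distrib] at hsum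
        simp only [Finset.sum_const, Finset.card_univ, Fintype.card_fin, nsmul_eq_mul,
          Finset.sum_ite_eq', Finset.mem_univ, if_true] at hsum
        have h6 : ((k * B + 1 : ℕ) : ℤ) < v m := by exact_mod_cast lt_of_le_of_lt hBN hm
        push_cast at h6
        nlinarith

theorem cone_good {k : ℕ} (P : Finset (Fin k → ℕ)) (A : Matrix (Fin k) (Fin k) ℕ)
    (hPA : ∀ x ∈ P, ∃ j, A j = x) (M N : ℕ) (hAM : ∀ i j, A i j ≤ M) (hPN : snorm P ≤ N)
    (hMN : k * M ≤ N) (a : Fin k → Fin k → ℤ) (d : ℤ) (hd : 0 < d)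
    (h1 : ∀ j l, ∑ i, a j i * (A l i : ℤ) = if j = l then d else 0)
    (h2 : ∀ (z : Fin k → ℤ) i, d * z i = ∑ j, (∑ m, a j m * z m) * (A j i : ℤ)) :
    Good N {z : Fin k → ℕ | z ∉ LSet {0} P ∧ (∀ j, 0 ≤ ∑ m, a j m * (z m : ℤ)) ∧
      ∀ j, A j ∉ P → ∑ m, a j m * (z m : ℤ) = 0} := by
  classical
  have hadd : ∀ j, ∀ v w : Fin k → ℕ, ∑ i, a j i * (((v + w) i : ℕ) : ℤ)
      = ∑ i, a j i * (v i : ℤ) + ∑ i, a j i * (w i : ℤ) := by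
    intro j v w
    simp [mul_add, Finset.sum_add_distrib]
  apply gen_box N _ P hPN
  · rintro v ⟨hvL, hv0, hvP⟩ p hp
    obtain ⟨l, rfl⟩ := hPA p hp
    refine ⟨?_, ?_, ?_⟩
    · rintro ⟨c, hc, lam, hlam⟩
      rw [Finset.mem_singleton] at hc
      subst hc
      rw [zero_add] at hlam
      -- the coefficient of `A l`
      have hμ : ∑ i, a l i * (((v + A l) i : ℕ) : ℤ) = lam (A l) * d := by
        rw [hlam]
        simp only [Finset.sum_apply, Pi.smul_apply, smul_eq_mul, Nat.cast_sum, Nat.cast_mul,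
          Finset.mul_sum]
        rw [Finset.sum_comm, Finset.sum_eq_single (A l)]
        · have := h1 l l
          rw [if_pos rfl] at this
          rw [← this, Finset.mul_sum]
          exact Finset.sum_congr rfl fun i _ => by ring
        · intro x hx hxl
          obtain ⟨j, rfl⟩ := hPA x hx
          have hne : l ≠ j := by rintro rfl; exact hxl rfl
          have := h1 l j
          rw [if_neg hne] at this
          rw [← mul_zero ((lam (A j) : ℕ) : ℤ), ← this, Finset.mul_sum]
          exact Finset.sum_congr rfl fun i _ => by ring
        · intro h; exact absurd hp h
      rw [hadd, h1, if_pos rfl] at hμ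
      have hpos : 1 ≤ lam (A l) := by
        by_contra hcon
        have : lam (A l) = 0 := by omega
        rw [this] at hμ
        have := hv0 l
        simp at hμ
        omega
      apply hvL
      refine ⟨0, by simp, fun x => lam x - if x = A l then 1 else 0, ?_⟩
      rw [zero_add]
      have h3 : ∑ x ∈ P, lam x • x
          = ∑ x ∈ P, (lam x - if x = A l then 1 else 0) • x + A l := by
        have h4 : A l = ∑ x ∈ P, (if x = A l then 1 else 0) • x := by
          simp only [ite_smul, one_smul, zero_smul]
          rw [Finset.sum_ite_eq' P (A l), if_pos hp]
        conv_rhs => rw [h4]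
        rw [← Finset.sum_add_distrib]
        refine Finset.sum_congr rfl fun x _ => ?_
        rw [← add_smul, ← h4]
        congr 1
        split_ifs with hx
        · rw [hx]; omega
        · omega
      rw [h3] at hlam
      exact add_right_cancel hlam
    · intro j
      rw [hadd, h1]
      have := hv0 j
      split_ifs <;> omega
    · intro j hj
      rw [hadd, h1, hvP j hj, if_neg]
      · simp
      · rintro rfl; exact hj hp
  · rintro v ⟨hvL, hv0, hvP⟩ i hi
    have hex : ∃ l, d ≤ ∑ m, a l m * (v m : ℤ) := by
      by_contra hcon
      push Not at hcon
      have h3 := h2 (fun m => (v m : ℤ)) i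
      have h4 : ∑ j, (∑ m, a j m * (v m : ℤ)) * (A j i : ℤ) ≤ ∑ _j : Fin k, d * M :=
        Finset.sum_le_sum fun j _ => by
          have h5 := (hcon j).le
          have h6 : (A j i : ℤ) ≤ M := by exact_mod_cast hAM j i
          have h7 := hv0 j
          gcongr
      rw [← h3] at h4
      simp only [Finset.sum_const, Finset.card_univ, Fintype.card_fin, nsmul_eq_mul] at h4
      have h8 : ((k * M : ℕ) : ℤ) < v i := by exact_mod_cast lt_of_le_of_lt hMN hi
      push_cast at h8
      nlinarith
    obtain ⟨l, hl⟩ := hex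
    have hlP : A l ∈ P := by
      by_contra h
      have := hvP l h
      omega
    have hμw : ∀ j, 0 ≤ ∑ m, a j m * (v m : ℤ) - (if j = l then d else 0) := by
      intro j
      have := hv0 j
      split_ifs with h
      · subst h; omega
      · omega
    have hle : ∀ m, A l m ≤ v m := by
      intro m
      have h3 := h2 (fun m => (v m : ℤ) - A l m) m
      have h4 : 0 ≤ ∑ j, (∑ m, a j m * ((v m : ℤ) - A l m)) * (A j m : ℤ) := by
        refine Finset.sum_nonneg fun j _ => mul_nonneg ?_ (Int.natCast_nonneg _)
        simp only [mul_sub, Finset.sum_sub_distrib]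
        rw [h1]
        exact hμw j
      rw [← h3] at h4
      have := nonneg_of_mul_nonneg_right h4 hd
      omega
    have hvw : v = (v - A l) + A l := by
      funext m
      have := hle m
      simp only [Pi.add_apply, Pi.sub_apply]; omega
    have hμ : ∀ j, ∑ m, a j m * (v m : ℤ)
        = ∑ m, a j m * (((v - A l) m : ℕ) : ℤ) + (if j = l then d else 0) := by
      intro j
      have := hadd j (v - A l) (A l)
      rwa [← hvw, h1] at this
    refine ⟨A l, hlP, ?_, v - A l, ⟨?_, ?_, ?_⟩, hvw⟩
    · intro h
      have := h1 l l
      rw [h, if_pos rfl] at this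
      simp at this
      omega
    · intro h
      apply hvL
      rw [hvw]
      exact LSet_add_mem h hlP
    · intro j
      have := hμ j
      have := hμw j
      omega
    · intro j hj
      have h5 := hμ j
      rw [hvP j hj, if_neg] at h5
      · omega
      · rintro rfl; exact hj hlP

theorem core {k : ℕ} (hk : 1 ≤ k) (P : Finset (Fin k → ℕ)) (hind : LinIndep P) (B N : ℕ)
    (hB1 : 1 ≤ B)
    (hB : ∀ n : ℤ, (n : ℝ) ≤ (k : ℝ) ^ ((k : ℝ) / 2) * (snorm P : ℝ) ^ k → n ≤ B)
    (hBN : k * B + 1 ≤ N) (hMN : k * snorm P ≤ N) :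
    ∃ S : Finset (Set (Fin k → ℕ)), S.card ≤ 2 ^ k + k - 1 ∧ (∀ V ∈ S, Good N V) ∧
      ∀ z, z ∉ LSet {0} P ↔ ∃ V ∈ S, z ∈ V := by
  classical
  have hk2 : k + 1 ≤ 2 ^ k := Nat.lt_two_pow_self
  rcases Finset.eq_empty_or_nonempty P with rfl | hne
  · refine ⟨{{z : Fin k → ℕ | 1 ≤ ∑ i, (1 : ℤ) * (z i : ℤ)}}, ?_, ?_, ?_⟩
    · simp; omega
    · intro V hV
      rw [Finset.mem_singleton] at hV
      subst hV
      apply half_good (fun _ => 1) B N _ hBN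
      intro i; simpa using hB1
    · intro z
      have : z ∈ LSet {0} (∅ : Finset (Fin k → ℕ)) ↔ z = 0 := by
        simp [LSet]
      rw [this]
      simp only [Finset.mem_singleton, exists_eq_left, Set.mem_ofPred_eq, one_mul]
      constructor
      · intro hz
        rcases Function.ne_iff.1 hz with ⟨i, hi⟩
        have h1 : z i ≤ ∑ i, z i :=
          Finset.single_le_sum (f := z) (fun _ _ => Nat.zero_le _) (Finset.mem_univ i)
        have h2 : 1 ≤ ∑ i, z i := le_trans (Nat.pos_of_ne_zero hi) h1
        exact_mod_cast h2
      · rintro h rfl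
        simp at h
  · obtain ⟨A, hdet, hPA, hAP⟩ := basis_ext P hind
    obtain ⟨x, hx⟩ := hne
    have hM : 1 ≤ snorm P := by
      by_contra hcon
      have h0 : x = 0 := by
        funext i
        have := le_snorm hx i
        simp only [Pi.zero_apply]
        omega
      obtain ⟨j, hj⟩ := hPA x hx
      apply hdet
      apply Matrix.det_eq_zero_of_row_eq_zero j
      intro i
      simp [Matrix.map_apply, hj, h0]
    have hAM : ∀ i j, A i j ≤ snorm P := by
      intro i j
      rcases hAP i with h | ⟨l, hl⟩
      · exact le_snorm h j
      · rw [hl, Pi.single_apply]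
        split_ifs <;> omega
    obtain ⟨a, d, hd, h1, h2, h3⟩ := functionals hk A hdet (snorm P) hM hAM
    let VA : Set (Fin k → ℕ) := {z : Fin k → ℕ | z ∉ LSet {0} P ∧
      (∀ j, 0 ≤ ∑ m, a j m * (z m : ℤ)) ∧ ∀ j, A j ∉ P → ∑ m, a j m * (z m : ℤ) = 0}
    let Vn : Fin k → Set (Fin k → ℕ) := fun j => {z | 1 ≤ ∑ m, (-a j m) * (z m : ℤ)}
    let Vp : Fin k → Set (Fin k → ℕ) := fun j => {z | 1 ≤ ∑ m, a j m * (z m : ℤ)}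
    let S1 : Finset (Set (Fin k → ℕ)) := Finset.univ.image Vn
    let S2 : Finset (Set (Fin k → ℕ)) := (Finset.univ.filter fun j => A j ∉ P).image Vp
    have hin : ∀ z ∈ LSet {0} P, (∀ j, 0 ≤ ∑ m, a j m * (z m : ℤ)) ∧
        ∀ j, A j ∉ P → ∑ m, a j m * (z m : ℤ) = 0 := by
      rintro z ⟨c, hc, lam, rfl⟩
      rw [Finset.mem_singleton] at hc
      subst hc
      have key : ∀ j, ∑ m, a j m * (((0 + ∑ x ∈ P, lam x • x : Fin k → ℕ) m : ℕ) : ℤ)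
          = ∑ x ∈ P, (lam x : ℤ) * ∑ m, a j m * (x m : ℤ) := by
        intro j
        rw [zero_add]
        simp only [Finset.sum_apply, Pi.smul_apply, smul_eq_mul, Nat.cast_sum, Nat.cast_mul,
          Finset.mul_sum]
        rw [Finset.sum_comm]
        exact Finset.sum_congr rfl fun x _ => Finset.sum_congr rfl fun i _ => by ring
      constructor
      · intro j
        rw [key]
        refine Finset.sum_nonneg fun x hx => mul_nonneg (Int.natCast_nonneg _) ?_
        obtain ⟨l, rfl⟩ := hPA x hx
        rw [h1]
        split_ifs <;> omega
      · intro j hj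
        rw [key]
        refine Finset.sum_eq_zero fun x hx => ?_
        obtain ⟨l, rfl⟩ := hPA x hx
        rw [h1, if_neg, mul_zero]
        rintro rfl; exact hj hx
    refine ⟨{VA} ∪ (S1 ∪ S2), ?_, ?_, ?_⟩
    · have c1 : S1.card ≤ k := Finset.card_image_le.trans (by simp)
      have c2 : S2.card < k := by
        refine lt_of_le_of_lt Finset.card_image_le ?_
        obtain ⟨j, hj⟩ := hPA x hx
        have : (Finset.univ.filter fun j => A j ∉ P) ⊂ Finset.univ := by
          rw [Finset.filter_ssubset]
          exact ⟨j, Finset.mem_univ _, by simp [hj, hx]⟩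
        simpa using Finset.card_lt_card this
      have c3 := Finset.card_union_le {VA} (S1 ∪ S2)
      have c4 := Finset.card_union_le S1 S2
      rw [Finset.card_singleton] at c3
      omega
    · intro V hV
      rcases Finset.mem_union.1 hV with h | h
      · rw [Finset.mem_singleton] at h
        rw [h]
        exact cone_good P A hPA (snorm P) N hAM
          ((Nat.le_mul_of_pos_left _ hk).trans hMN) hMN a d hd h1 h2
      · rcases Finset.mem_union.1 h with h | h
        · obtain ⟨j, _, rfl⟩ := Finset.mem_image.1 h
          refine half_good (fun m => -a j m) B N (fun i => ?_) hBN
          rw [abs_neg]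
          exact hB _ (h3 j i)
        · obtain ⟨j, _, rfl⟩ := Finset.mem_image.1 h
          exact half_good (fun m => a j m) B N (fun i => hB _ (h3 j i)) hBN
    · intro z
      constructor
      · intro hz
        by_cases hz1 : ∃ j, ∑ m, a j m * (z m : ℤ) < 0
        · obtain ⟨j, hj⟩ := hz1
          refine ⟨Vn j, by simp [S1], ?_⟩
          simp only [Vn, Set.mem_ofPred_eq, neg_mul, Finset.sum_neg_distrib]
          omega
        · push Not at hz1
          by_cases hz2 : ∃ j, A j ∉ P ∧ 0 < ∑ m, a j m * (z m : ℤ)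
          · obtain ⟨j, hj, hj2⟩ := hz2
            refine ⟨Vp j, ?_, ?_⟩
            · refine Finset.mem_union_right _ (Finset.mem_union_right _ ?_)
              exact Finset.mem_image.2 ⟨j, by simp [hj], rfl⟩
            · simp only [Vp, Set.mem_ofPred_eq]
              omega
          · push Not at hz2
            refine ⟨VA, by simp, hz, hz1, fun j hj => le_antisymm (hz2 j hj) (hz1 j)⟩
      · rintro ⟨V, hV, hzV⟩ hz
        obtain ⟨hz1, hz2⟩ := hin z hz
        rcases Finset.mem_union.1 hV with h | h
        · rw [Finset.mem_singleton] at h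
          rw [h] at hzV
          exact hzV.1 hz
        · rcases Finset.mem_union.1 h with h | h
          · obtain ⟨j, _, rfl⟩ := Finset.mem_image.1 h
            simp only [Vn, Set.mem_ofPred_eq, neg_mul, Finset.sum_neg_distrib] at hzV
            have := hz1 j
            omega
          · obtain ⟨j, hj, rfl⟩ := Finset.mem_image.1 h
            simp only [Vp, Set.mem_ofPred_eq] at hzV
            have := hz2 j (Finset.mem_filter.1 hj).2
            omega

theorem slab {k : ℕ} (i : Fin k) (n : ℕ) : ∃ C Q : Finset (Fin k → ℕ),
    snorm Q ≤ 1 ∧ snorm C ≤ n ∧ C.card ≤ n ∧ {z : Fin k → ℕ | z i < n} = LSet C Q := by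
  classical
  refine ⟨(Finset.range n).image fun c => Pi.single i c,
    (Finset.univ.filter fun j => j ≠ i).image fun j => Pi.single j 1, ?_, ?_, ?_, ?_⟩
  · apply snorm_le
    intro x hx l
    obtain ⟨j, _, rfl⟩ := Finset.mem_image.1 hx
    rw [Pi.single_apply]; split_ifs <;> omega
  · apply snorm_le
    intro x hx l
    obtain ⟨j, hj, rfl⟩ := Finset.mem_image.1 hx
    have := Finset.mem_range.1 hj
    rw [Pi.single_apply]; split_ifs <;> omega
  · exact Finset.card_image_le.trans (by simp)
  · apply gen
    · intro c hc
      obtain ⟨j, hj, rfl⟩ := Finset.mem_image.1 hc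
      simpa using hj
    · intro v hv p hp
      obtain ⟨j, hj, rfl⟩ := Finset.mem_image.1 hp
      have hji := (Finset.mem_filter.1 hj).2
      simp only [Set.mem_ofPred_eq, Pi.add_apply] at hv ⊢
      rw [Pi.single_eq_of_ne hji.symm]
      exact hv
    · intro v hv
      simp only [Set.mem_ofPred_eq] at hv
      by_cases h : ∃ j, j ≠ i ∧ v j ≠ 0
      · right
        obtain ⟨j, hji, hj⟩ := h
        refine ⟨Pi.single j 1, Finset.mem_image.2 ⟨j, by simp [hji], rfl⟩, by simp,
          v - Pi.single j 1, ?_, ?_⟩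
        · simp only [Set.mem_ofPred_eq, Pi.sub_apply]
          omega
        · funext l
          simp only [Pi.add_apply, Pi.sub_apply, Pi.single_apply]
          split_ifs with hl
          · subst hl; omega
          · omega
      · left
        push Not at h
        refine Finset.mem_image.2 ⟨v i, Finset.mem_range.2 hv, ?_⟩
        funext l
        by_cases hl : l = i
        · subst hl; simp
        · rw [Pi.single_eq_of_ne hl, h l hl]

theorem LSet_image_add {k : ℕ} (x₀ : Fin k → ℕ) (C Q : Finset (Fin k → ℕ)) :
    LSet (C.map (addLeftEmbedding x₀)) Q = (fun z => x₀ + z) '' LSet C Q := by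
  ext v
  constructor
  · rintro ⟨c, hc, lam, rfl⟩
    obtain ⟨c', hc', rfl⟩ := Finset.mem_map.1 hc
    exact ⟨_, ⟨c', hc', lam, rfl⟩, by simp [add_assoc]⟩
  · rintro ⟨_, ⟨c, hc, lam, rfl⟩, rfl⟩
    exact ⟨x₀ + c, Finset.mem_map.2 ⟨c, hc, rfl⟩, lam, by simp [add_assoc]⟩

theorem nat_main {k : ℕ} (hk : 1 ≤ k) (P : Finset (Fin k → ℕ)) (hind : LinIndep P)
    (x₀ : Fin k → ℕ) (B N : ℕ) (hB1 : 1 ≤ B)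
    (hB : ∀ n : ℤ, (n : ℝ) ≤ (k : ℝ) ^ ((k : ℝ) / 2) * (snorm P : ℝ) ^ k → n ≤ B)
    (hBN : k * B + 1 ≤ N) (hMN : k * snorm P ≤ N) :
    ∃ (I : Finset ℕ) (C' P' : ℕ → Finset (Fin k → ℕ)),
      I.card ≤ 2 ^ k + 2 * k - 1 ∧
      (∀ i ∈ I, snorm (P' i) ≤ N ∧ snorm (C' i) ≤ N + vnorm x₀ ∧
        (C' i).card ≤ max ((N + 1) ^ k) (vnorm x₀)) ∧
      (LSet1 x₀ P)ᶜ = ⋃ i ∈ I, LSet (C' i) (P' i) := by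
  classical
  obtain ⟨S, hScard, hSgood, hS⟩ := core hk P hind B N hB1 hB hBN hMN
  let T : Finset (Set (Fin k → ℕ)) :=
    S.image (fun V => (fun z => x₀ + z) '' V) ∪
      Finset.univ.image (fun i : Fin k => {z : Fin k → ℕ | z i < x₀ i})
  have hTcard : T.card ≤ 2 ^ k + 2 * k - 1 := by
    have c1 := Finset.card_union_le (S.image (fun V => (fun z => x₀ + z) '' V))
      (Finset.univ.image (fun i : Fin k => {z : Fin k → ℕ | z i < x₀ i}))
    have c2 : (S.image (fun V => (fun z => x₀ + z) '' V)).card ≤ S.card := Finset.card_image_le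
    have c3 : (Finset.univ.image (fun i : Fin k => {z : Fin k → ℕ | z i < x₀ i})).card ≤ k :=
      Finset.card_image_le.trans (by simp)
    have : T.card ≤ S.card + k := c1.trans (add_le_add c2 c3)
    have : 1 ≤ 2 ^ k := Nat.one_le_two_pow
    omega
  have hTgood : ∀ V ∈ T, ∃ C Q : Finset (Fin k → ℕ), snorm Q ≤ N ∧ snorm C ≤ N + vnorm x₀ ∧
      C.card ≤ max ((N + 1) ^ k) (vnorm x₀) ∧ V = LSet C Q := by
    intro V hV
    rcases Finset.mem_union.1 hV with h | h
    · obtain ⟨W, hW, rfl⟩ := Finset.mem_image.1 h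
      obtain ⟨C, Q, hQ, hC, hc, rfl⟩ := hSgood W hW
      refine ⟨C.map (addLeftEmbedding x₀), Q, hQ, ?_, ?_, (LSet_image_add _ _ _).symm⟩
      · apply snorm_le
        intro x hx i
        obtain ⟨c, hcC, rfl⟩ := Finset.mem_map.1 hx
        have h1 := le_snorm hcC i
        have h2 := le_vnorm x₀ i
        simp only [addLeftEmbedding_apply, Pi.add_apply]
        omega
      · rw [Finset.card_map]
        exact hc.trans (le_max_left _ _)
    · obtain ⟨i, _, rfl⟩ := Finset.mem_image.1 h
      obtain ⟨C, Q, hQ, hC, hc, hV⟩ := slab i (x₀ i)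
      have h2 := le_vnorm x₀ i
      exact ⟨C, Q, by omega, by omega, (hc.trans h2).trans (le_max_right _ _), hV⟩
  have hTU : ∀ z, z ∉ LSet1 x₀ P ↔ ∃ V ∈ T, z ∈ V := by
    intro z
    have hL : LSet1 x₀ P = (fun z => x₀ + z) '' LSet {0} P := by
      rw [← LSet_image_add, LSet1]
      simp
    rw [hL]
    constructor
    · intro hz
      by_cases hx : ∃ i, z i < x₀ i
      · obtain ⟨i, hi⟩ := hx
        exact ⟨_, Finset.mem_union_right _ (Finset.mem_image.2 ⟨i, Finset.mem_univ _, rfl⟩), hi⟩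
      · push Not at hx
        have hzz : x₀ + (z - x₀) = z := by
          funext i
          have := hx i
          simp only [Pi.add_apply, Pi.sub_apply]; omega
        have h1 : z - x₀ ∉ LSet {0} P := fun h => hz ⟨_, h, hzz⟩
        obtain ⟨V, hV, hzV⟩ := (hS _).1 h1
        exact ⟨_, Finset.mem_union_left _ (Finset.mem_image.2 ⟨V, hV, rfl⟩), _, hzV, hzz⟩
    · rintro ⟨V, hV, hzV⟩ ⟨w, hw, rfl⟩
      rcases Finset.mem_union.1 hV with h | h
      · obtain ⟨W, hW, rfl⟩ := Finset.mem_image.1 h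
        obtain ⟨w', hw', he⟩ := hzV
        have : w' = w := add_left_cancel he
        subst this
        exact (hS _).2 ⟨W, hW, hw'⟩ hw
      · obtain ⟨i, _, rfl⟩ := Finset.mem_image.1 h
        simp at hzV
  choose! C Q hQ hC hc hE using hTgood
  let e := T.equivFin
  let g : ℕ → Set (Fin k → ℕ) := fun n => if h : n < T.card then (e.symm ⟨n, h⟩ : Set _) else ∅
  have hg : ∀ n ∈ Finset.range T.card, g n ∈ T := by
    intro n hn
    have := Finset.mem_range.1 hn
    simp only [g, dif_pos this]
    exact (e.symm ⟨n, this⟩).2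
  refine ⟨Finset.range T.card, fun n => C (g n), fun n => Q (g n), by simpa using hTcard,
    fun n hn => ⟨hQ _ (hg n hn), hC _ (hg n hn), hc _ (hg n hn)⟩, ?_⟩
  ext z
  rw [Set.mem_compl_iff, hTU]
  simp only [Set.mem_iUnion]
  constructor
  · rintro ⟨V, hV, hz⟩
    refine ⟨e ⟨V, hV⟩, Finset.mem_range.2 (e ⟨V, hV⟩).2, ?_⟩
    have : g (e ⟨V, hV⟩) = V := by simp [g]
    rw [this, ← hE V hV]
    exact hz
  · rintro ⟨n, hn, hz⟩
    rw [← hE _ (hg n hn)] at hz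
    exact ⟨g n, hg n hn, hz⟩

/-- Complement of a linear set `L(x₀,P)` with linearly independent periods. -/
theorem compl_linear (k : ℕ) (hk : 1 ≤ k)
    (P : Finset (Fin k → ℕ)) (hind : LinIndep P) (x₀ : Fin k → ℕ) :
    ∃ (I : Finset ℕ) (C' P' : ℕ → Finset (Fin k → ℕ)),
      I.card ≤ 2 ^ k + 2 * k - 1 ∧
      (∀ i ∈ I,
        (snorm (P' i) : ℝ) ≤
          (2 * (k : ℝ) + 1) * (k : ℝ) ^ ((k : ℝ) / 2) * ((snorm P : ℝ) + 1) ^ k ∧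
        (snorm (C' i) : ℝ) ≤
          (2 * (k : ℝ) + 1) * (k : ℝ) ^ ((k : ℝ) / 2) * ((snorm P : ℝ) + 1) ^ k
            + (vnorm x₀ : ℝ) ∧
        ((C' i).card : ℝ) ≤
          max (4 ^ k * (k : ℝ) ^ ((k : ℝ) ^ 2 / 2 + (k : ℝ)) * ((snorm P : ℝ) + 1) ^ (k ^ 2))
            (vnorm x₀ : ℝ)) ∧
      (LSet1 x₀ P)ᶜ = ⋃ i ∈ I, LSet (C' i) (P' i) := by
  set M := snorm P with hM
  set H : ℝ := (k : ℝ) ^ ((k : ℝ) / 2) * ((M : ℝ) + 1) ^ k with hH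
  have hk1 : (1 : ℝ) ≤ k := by exact_mod_cast hk
  have hM0 : (0 : ℝ) ≤ M := Nat.cast_nonneg _
  have hkk : (1 : ℝ) ≤ (k : ℝ) ^ ((k : ℝ) / 2) := Real.one_le_rpow hk1 (by positivity)
  have hMk : (M : ℝ) + 1 ≤ ((M : ℝ) + 1) ^ k := le_self_pow₀ (by linarith) (by omega)
  have hHM : (M : ℝ) + 1 ≤ H := by
    rw [hH]; nlinarith
  have hH1 : 1 ≤ H := by linarith
  have hfl : ((⌊H⌋₊ : ℕ) : ℝ) ≤ H := Nat.floor_le (by linarith)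
  have hN : ((⌊(2 * (k : ℝ) + 1) * H⌋₊ : ℕ) : ℝ) ≤ (2 * (k : ℝ) + 1) * H :=
    Nat.floor_le (by positivity)
  obtain ⟨I, C', P', hI, hb, hU⟩ := nat_main hk P hind x₀ ⌊H⌋₊ ⌊(2 * (k : ℝ) + 1) * H⌋₊
    (Nat.le_floor (by simpa using hH1))
    (by
      intro n hn
      rcases le_or_gt n 0 with h0 | h0
      · exact h0.trans (Int.natCast_nonneg _)
      · obtain ⟨m, rfl⟩ := Int.eq_ofNat_of_zero_le h0.le
        have : m ≤ ⌊H⌋₊ := by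
          apply Nat.le_floor
          refine le_trans (by simpa using hn) ?_
          rw [hH]
          gcongr
          linarith
        exact_mod_cast this)
    (by
      apply Nat.le_floor
      push_cast
      nlinarith)
    (by
      apply Nat.le_floor
      push_cast
      nlinarith)
  refine ⟨I, C', P', hI, fun i hi => ?_, hU⟩
  obtain ⟨b1, b2, b3⟩ := hb i hi
  have e1 : (2 * (k : ℝ) + 1) * (k : ℝ) ^ ((k : ℝ) / 2) * ((M : ℝ) + 1) ^ k
      = (2 * (k : ℝ) + 1) * H := by rw [hH]; ring
  rw [e1]
  refine ⟨?_, ?_, ?_⟩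
  · exact le_trans (by exact_mod_cast b1) hN
  · have : (snorm (C' i) : ℝ) ≤ (⌊(2 * (k : ℝ) + 1) * H⌋₊ : ℕ) + (vnorm x₀ : ℝ) := by
      exact_mod_cast b2
    linarith
  · have : ((C' i).card : ℝ)
        ≤ max ((((⌊(2 * (k : ℝ) + 1) * H⌋₊ : ℕ) : ℝ) + 1) ^ k) (vnorm x₀ : ℝ) := by
      exact_mod_cast b3
    refine this.trans (max_le_max ?_ le_rfl)
    have e2 : 4 ^ k * (k : ℝ) ^ ((k : ℝ) ^ 2 / 2 + (k : ℝ)) * ((M : ℝ) + 1) ^ (k ^ 2)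
        = (4 * k * H) ^ k := by
      have hkp : (0 : ℝ) < k := by linarith
      rw [hH, mul_pow, mul_pow, mul_pow, Real.rpow_add hkp, Real.rpow_natCast, ← pow_mul,
        ← Real.rpow_natCast ((k : ℝ) ^ ((k : ℝ) / 2)), ← Real.rpow_mul hkp.le]
      have : (k : ℝ) / 2 * (k : ℝ) = (k : ℝ) ^ 2 / 2 := by ring
      rw [this, sq k]
      ring
    rw [e2]
    apply pow_le_pow_left₀ (by positivity)
    nlinarith
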